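/- arXiv:2303.17205 — 5 statements merged into one kernel-verified Lean document; each statement's English description precedes it below -/
import Mathlib

section
/- Let K be a field equipped with a valuation ω : K → ℝ ∪ {+∞} such that ω(K*) ⊇ ℤ, whose valuation ring O is Henselian, and let m be a positive integer. Then there exist a positive integer K₀ and a natural number K′ such that for every positive integer n and every a ∈ O with ω(a^m − 1) ≥ n, one can write a = b + c with b, c ∈ O, b^m = 1 and ω(c) ≥ n/K₀ − K′. -/
open Polynomial in
theorem hensel_aux {R : Type*} [CommRing R] [HenselianLocalRing R] (j : ℕ) (c : R)
    (hc : c ∈ IsLocalRing.maximalIdeal R) :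
    ∃ x : R, IsUnit x ∧ (x + ((j + 2 : ℕ) : R) * c) ^ (j + 2)
      = (1 - ((j + 2 : ℕ) : R) ^ 2 * c) * x ^ (j + 2) := by
  set N : R := ((j + 2 : ℕ) : R) with hN
  set q : R[X] := ∑ k ∈ Finset.range (j + 1),
    C ((N * c) ^ k * ((j + 2).choose (k + 2) : R)) * X ^ (j - k) with hq
  have hqdeg : q.degree < ((j + 2 : ℕ) : WithBot ℕ) := by
    refine lt_of_le_of_lt (degree_sum_le _ _) ?_
    rw [Finset.sup_lt_iff (by exact WithBot.bot_lt_coe _)]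
    intro k _
    refine lt_of_le_of_lt (degree_C_mul_X_pow_le _ _) ?_
    exact_mod_cast (by omega : j - k < j + 2)
  have hexp : ∀ x : R, (x + N * c) ^ (j + 2)
      = x ^ (j + 2) + N ^ 2 * c * x ^ (j + 1) + (N * c) ^ 2 * q.eval x := by
    intro x
    rw [add_comm x, add_pow, Finset.sum_range_succ', Finset.sum_range_succ', hq, eval_finsetSum,
      Finset.mul_sum]
    have : ∀ k ∈ Finset.range (j + 1),
        (N * c) ^ (k + 1 + 1) * x ^ (j + 2 - (k + 1 + 1)) * ((j + 2).choose (k + 1 + 1) : R)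
        = (N * c) ^ 2 * eval x (C ((N * c) ^ k * ((j + 2).choose (k + 2) : R)) * X ^ (j - k)) := by
      intro k _
      have e : j + 2 - (k + 1 + 1) = j - k := by omega
      rw [e]
      simp only [eval_mul, eval_C, eval_pow, eval_X]
      ring
    rw [Finset.sum_congr rfl this]
    have e : j + 2 - (0 + 1) = j + 1 := by omega
    rw [e]
    simp only [zero_add, Nat.choose_one_right, Nat.choose_zero_right, ← hN]
    simp
    ring
  set h : R[X] := X ^ (j + 2) + (X ^ (j + 1) + C c * q) with hh
  have hmonic : h.Monic := by
    apply monic_X_pow_add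
    refine lt_of_le_of_lt (degree_add_le _ _) (max_lt ?_ ?_)
    · refine lt_of_le_of_lt (degree_X_pow_le _) ?_
      exact_mod_cast (by omega : j + 1 < j + 2)
    · rw [← smul_eq_C_mul]
      exact lt_of_le_of_lt (degree_smul_le _ _) hqdeg
  have h1 : h.eval (-1) ∈ IsLocalRing.maximalIdeal R := by
    have : h.eval (-1) = q.eval (-1) * c := by
      simp only [hh, eval_add, eval_mul, eval_C, eval_pow, eval_X]
      ring
    rw [this]
    exact Ideal.mul_mem_left _ _ hc
  have unit_add : ∀ u d : R, IsUnit u → d ∈ IsLocalRing.maximalIdeal R → IsUnit (u + d) := by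
    intro u d hu hd
    by_contra hcon
    have h2 : u + d ∈ IsLocalRing.maximalIdeal R := (IsLocalRing.mem_maximalIdeal _).2 hcon
    have h3 : u ∈ IsLocalRing.maximalIdeal R := by
      have := Ideal.sub_mem _ h2 hd
      simpa using this
    exact (IsLocalRing.mem_maximalIdeal _).1 h3 hu
  have h2 : IsUnit (h.derivative.eval (-1)) := by
    have : h.derivative.eval (-1) = (-1) ^ (j + 1) + q.derivative.eval (-1) * c := by
      simp [hh]
      ring
    rw [this]
    exact unit_add _ _ ((isUnit_one.neg).pow _) (Ideal.mul_mem_left _ _ hc)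
  obtain ⟨x, hx, hx1⟩ := HenselianLocalRing.is_henselian h hmonic (-1) h1 h2
  refine ⟨x, ?_, ?_⟩
  · have := unit_add (-1) _ isUnit_one.neg hx1
    simpa using this
  · rw [hexp]
    have h0 : x ^ (j + 2) + (x ^ (j + 1) + c * q.eval x) = 0 := by
      simpa [hh] using hx
    linear_combination N ^ 2 * c * h0

theorem tame_aux {K : Type*} [Field K] (ω : K → WithTop ℝ)
    (hmul : ∀ x y : K, ω (x * y) = ω x + ω y)
    (hzero : ∀ x : K, ω x = ⊤ ↔ x = 0)
    (O : Subring K) (hO : ∀ x : K, x ∈ O ↔ 0 ≤ ω x)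
    [HenselianLocalRing O]
    (m : ℕ) (hm : (m : K) ≠ 0) :
    ∃ K' : ℕ,
      ∀ r : ℝ, 0 < r → ∀ a : K, a ∈ O → ((r : ℝ) : WithTop ℝ) ≤ ω (a ^ m - 1) →
        ∃ b c : K, b ∈ O ∧ c ∈ O ∧ a = b + c ∧ b ^ m = 1 ∧
          ((r - (K' : ℝ) : ℝ) : WithTop ℝ) ≤ ω c := by
  have hone : ω 1 = 0 := by
    have h1 := hmul 1 1
    have h2 : ω 1 ≠ ⊤ := fun h => one_ne_zero ((hzero 1).1 h)
    lift ω 1 to ℝ using h2 with w hw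
    rw [mul_one, ← hw] at h1
    norm_cast at h1 ⊢
    linarith
  have hmax : ∀ x : O, 0 < ω (x : K) → x ∈ IsLocalRing.maximalIdeal O := by
    intro x hx
    rw [IsLocalRing.mem_maximalIdeal]
    intro hu
    obtain ⟨y, hy⟩ := hu.exists_right_inv
    have h1 : (x : K) * y = 1 := by exact_mod_cast congrArg Subtype.val hy
    have h2 := hmul x y
    rw [h1, hone] at h2
    have h3 : 0 ≤ ω (y : K) := (hO _).1 y.2
    have : 0 < ω (x : K) + ω (y : K) := add_pos_of_pos_of_nonneg hx h3
    rw [← h2] at this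
    exact lt_irrefl _ this
  have hs : ω ((m : K) ^ 2) ≠ ⊤ := fun h => pow_ne_zero 2 hm ((hzero _).1 h)
  obtain ⟨s, hs⟩ := WithTop.ne_top_iff_exists.1 hs
  obtain ⟨K', hK'⟩ := exists_nat_ge s
  refine ⟨K', fun r hr a ha har => ?_⟩
  by_cases hcase : r ≤ K' ∨ m = 1
  · refine ⟨1, a - 1, O.one_mem, O.sub_mem ha O.one_mem, by ring, one_pow _, ?_⟩
    rcases hcase with h | h
    · refine le_trans ?_ ((hO _).1 (O.sub_mem ha O.one_mem))
      exact_mod_cast (by linarith : r - (K' : ℝ) ≤ 0)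
    · subst h
      rw [pow_one] at har
      refine le_trans ?_ har
      have : (0 : ℝ) ≤ K' := Nat.cast_nonneg _
      exact_mod_cast (by linarith : r - (K' : ℝ) ≤ r)
  push Not at hcase
  obtain ⟨hrK, hm1⟩ := hcase
  have hm0 : m ≠ 0 := by rintro rfl; simp at hm
  obtain ⟨j, rfl⟩ : ∃ j, m = j + 2 := ⟨m - 2, by omega⟩
  set m := j + 2 with hmj
  -- a is a unit
  have hdO : a ^ m - 1 ∈ O := O.sub_mem (O.pow_mem ha _) O.one_mem
  have hdpos : 0 < ω (a ^ m - 1) := lt_of_lt_of_le (by exact_mod_cast hr) har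
  have hdm := hmax ⟨_, hdO⟩ hdpos
  have hau : IsUnit ((⟨a, ha⟩ : O) ^ m) := by
    by_contra hcon
    have h2 := (IsLocalRing.mem_maximalIdeal _).2 hcon
    have h3 := Ideal.sub_mem _ h2 hdm
    have h4 : (⟨a, ha⟩ : O) ^ m - ⟨_, hdO⟩ = 1 := by
      ext; simp
    rw [h4] at h3
    exact (IsLocalRing.mem_maximalIdeal _).1 h3 isUnit_one
  obtain ⟨u, hu⟩ := hau.exists_right_inv
  have hu' : a ^ m * (u : K) = 1 := congrArg (Subtype.val : O → K) hu
  set c : K := (a ^ m - 1) * u / (m : K) ^ 2 with hc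
  have hcm : c * (m : K) ^ 2 = (a ^ m - 1) * u := by
    rw [hc]; field_simp
  have hcω : ((r - (K' : ℝ) : ℝ) : WithTop ℝ) ≤ ω c := by
    have h1 : (r : WithTop ℝ) ≤ ω c + ω ((m : K) ^ 2) := by
      rw [← hmul, hcm, hmul]
      exact le_add_of_le_of_nonneg har ((hO _).1 u.2)
    rw [← hs] at h1
    by_cases ht : ω c = ⊤
    · rw [ht]; exact le_top
    · obtain ⟨t, ht⟩ := WithTop.ne_top_iff_exists.1 ht
      rw [← ht] at h1 ⊢
      norm_cast at h1 ⊢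
      linarith
  have hcpos : 0 < ω c := lt_of_lt_of_le (by exact_mod_cast (by linarith : (0:ℝ) < r - K')) hcω
  have hcO : c ∈ O := (hO _).2 hcpos.le
  obtain ⟨x, hxu, hx⟩ := hensel_aux j (⟨c, hcO⟩ : O) (hmax ⟨c, hcO⟩ hcpos)
  obtain ⟨y, hy⟩ := hxu.exists_right_inv
  have hy' : (x : K) * y = 1 := by exact_mod_cast congrArg Subtype.val hy
  have hx' : ((x : K) + (m : K) * c) ^ m = (1 - (m : K) ^ 2 * c) * (x : K) ^ m := by
    have := congrArg (O.subtype) hx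
    simp only [map_mul, map_pow, map_add, map_sub, map_one, map_natCast] at this
    exact this
  have hmO : (m : K) ∈ O := natCast_mem O m
  have hzO : -(a * m * y : K) ∈ O := O.neg_mem (O.mul_mem (O.mul_mem ha hmO) y.2)
  refine ⟨a * (x + m * c) * y, -(a * m * y) * c, ?_, O.mul_mem hzO hcO, ?_, ?_, ?_⟩
  · exact O.mul_mem (O.mul_mem ha (O.add_mem x.2 (O.mul_mem hmO hcO))) y.2
  · linear_combination (-a) * hy'
  · rw [mul_pow, mul_pow, hx']
    have h1 : (x : K) ^ m * (y : K) ^ m = 1 := by rw [← mul_pow, hy', one_pow]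
    have h2 : a ^ m * (1 - (m : K) ^ 2 * c) = 1 := by
      linear_combination (-a ^ m) * hcm + (1 - a ^ m) * hu'
    linear_combination (a ^ m * (1 - (m : K) ^ 2 * c)) * h1 + h2
  · rw [hmul]
    exact le_add_of_nonneg_of_le ((hO _).1 hzO) hcω


/-- Uniform root-of-unity decomposition (Lemma 4.14): over a Henselian valued field
with `ω (K*) ⊇ ℤ`, there exist `K₀ > 0` and `K'` such that any `a ∈ O` with
`ω (a ^ m - 1) ≥ n` decomposes as `a = b + c`, `b ^ m = 1`, `ω c ≥ n / K₀ - K'`. -/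
theorem stmt_1 {K : Type*} [Field K] (ω : K → WithTop ℝ)
    (hmul : ∀ x y : K, ω (x * y) = ω x + ω y)
    (hadd : ∀ x y : K, min (ω x) (ω y) ≤ ω (x + y))
    (hzero : ∀ x : K, ω x = ⊤ ↔ x = 0)
    (hZ : ∀ k : ℤ, ∃ x : K, x ≠ 0 ∧ ω x = ((k : ℝ) : WithTop ℝ))
    (O : Subring K) (hO : ∀ x : K, x ∈ O ↔ 0 ≤ ω x)
    [HenselianLocalRing O]
    (m : ℕ) (hm : 0 < m) :
    ∃ K₀ : ℕ, 0 < K₀ ∧ ∃ K' : ℕ,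
      ∀ n : ℕ, 0 < n → ∀ a : K, a ∈ O → ((n : ℝ) : WithTop ℝ) ≤ ω (a ^ m - 1) →
        ∃ b c : K, b ∈ O ∧ c ∈ O ∧ a = b + c ∧ b ^ m = 1 ∧
          (((n : ℝ) / (K₀ : ℝ) - (K' : ℝ) : ℝ) : WithTop ℝ) ≤ ω c := by
  -- write `m = q * m'` with Frobenius-like `q`
  have key : ∃ q m' : ℕ, 0 < q ∧ m = m' * q ∧ (m' : K) ≠ 0 ∧
      ∀ x : K, x ^ q - 1 = (x - 1) ^ q := by
    obtain ⟨p, hp⟩ := CharP.exists K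
    rcases CharP.char_is_prime_or_zero K p with hpp | h0
    · obtain ⟨e, m', hm', he⟩ := Nat.exists_eq_pow_mul_and_not_dvd hm.ne' p hpp.ne_one
      haveI : Fact p.Prime := ⟨hpp⟩
      refine ⟨p ^ e, m', pow_pos hpp.pos e, by rw [he, mul_comm], ?_, ?_⟩
      · rwa [Ne, CharP.cast_eq_zero_iff K p]
      · intro x
        rw [sub_pow_char_pow, one_pow]
    · subst h0
      haveI : CharZero K := CharP.charP_to_charZero K
      exact ⟨1, m, one_pos, by ring, by exact_mod_cast hm.ne', fun x => by simp⟩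
  obtain ⟨q, m', hq, hmq, hm', hfrob⟩ := key
  obtain ⟨K', hK'⟩ := tame_aux ω hmul hzero O hO m' hm'
  refine ⟨q, hq, K', fun n hn a ha han => ?_⟩
  have hqR : (0 : ℝ) < q := by exact_mod_cast hq
  have hpow : ∀ (x : K) (t : ℝ), ω x = t → ∀ k : ℕ, ω (x ^ (k + 1)) = (((k + 1 : ℕ) : ℝ) * t : ℝ) := by
    intro x t ht k
    induction k with
    | zero => simp [ht]
    | succ k ih =>
      rw [pow_succ, hmul, ih, ht]
      norm_cast
      push_cast
      ring
  have hle : (((n : ℝ) / q : ℝ) : WithTop ℝ) ≤ ω (a ^ m' - 1) := by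
    rw [hmq, pow_mul, hfrob] at han
    by_cases ht : ω (a ^ m' - 1) = ⊤
    · rw [ht]; exact le_top
    · obtain ⟨t, ht⟩ := WithTop.ne_top_iff_exists.1 ht
      have h1 := hpow _ t ht.symm (q - 1)
      rw [Nat.sub_add_cancel hq] at h1
      rw [h1] at han
      rw [← ht]
      rw [WithTop.coe_le_coe] at han ⊢
      rw [div_le_iff₀ hqR]
      linarith
  obtain ⟨b, c, hb, hc, h1, h2, h3⟩ := hK' ((n : ℝ) / q) (by positivity) a ha hle
  exact ⟨b, c, hb, hc, h1, by rw [hmq, pow_mul, h2, one_pow], h3⟩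
end

section
/- Let K be a field equipped with a valuation ω : K → ℝ ∪ {+∞}. Let m be a positive integer such that ω(m·1_K) = 0 (in particular m·1_K ≠ 0 in K). Let b, c ∈ K with b^m = 1 and ω(c) > 0. Then ω((b + c)^m − 1) = ω(c). -/
/-- Key valuation computation: if `ω (m : K) = 0`, `b ^ m = 1` and `ω c > 0`,
then `ω ((b + c) ^ m - 1) = ω c`. -/
theorem stmt_2 {K : Type*} [Field K] (ω : K → WithTop ℝ)
    (hmul : ∀ x y : K, ω (x * y) = ω x + ω y)
    (hadd : ∀ x y : K, min (ω x) (ω y) ≤ ω (x + y))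
    (hzero : ∀ x : K, ω x = ⊤ ↔ x = 0)
    (m : ℕ) (hm : 0 < m) (hmK : ω ((m : K)) = 0)
    (b c : K) (hb : b ^ m = 1) (hc : 0 < ω c) :
    ω ((b + c) ^ m - 1) = ω c := by
  have h1 : ω 1 = 0 := by
    have h := hmul 1 1
    have hne : ω 1 ≠ ⊤ := fun h => one_ne_zero ((hzero 1).1 h)
    obtain ⟨r, hr⟩ := WithTop.ne_top_iff_exists.1 hne
    rw [mul_one, ← hr] at h
    rw [← hr]
    have h' : r = r + r := by exact_mod_cast h
    have : r = 0 := by linarith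
    rw [this]; rfl
  obtain ⟨v, hv⟩ : ∃ v : AddValuation K (WithTop ℝ), ∀ x, v x = ω x :=
    ⟨AddValuation.of ω ((hzero 0).2 rfl) h1 hadd hmul, fun x => rfl⟩
  have hvb : v b = 0 := by
    have h : v (b ^ m) = 0 := by rw [hb, hv, h1]
    rw [v.map_pow] at h
    have hne : v b ≠ ⊤ := by
      rw [hv]; intro h
      rw [(hzero b).1 h, zero_pow hm.ne'] at hb
      exact zero_ne_one hb
    obtain ⟨r, hr⟩ := WithTop.ne_top_iff_exists.1 hne
    rw [← hr] at h ⊢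
    have h' : m • r = 0 := by exact_mod_cast h
    have : r = 0 := by
      rcases smul_eq_zero.1 h' with h | h
      · omega
      · exact h
    rw [this]; rfl
  have hnat : ∀ n : ℕ, 0 ≤ v (n : K) := by
    intro n
    induction n with
    | zero => simp
    | succ n ih =>
      rw [Nat.cast_succ]
      exact v.map_le_add ih (by rw [v.map_one])
  have hvbn : ∀ n : ℕ, v (b ^ n) = 0 := fun n => by rw [v.map_pow, hvb, smul_zero]
  have key : ∀ n : ℕ, ∃ k, 0 ≤ v k ∧
      (b + c) ^ (n + 1) = b ^ (n + 1) + ((n + 1 : ℕ) : K) * b ^ n * c + c ^ 2 * k := by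
    intro n
    induction n with
    | zero => exact ⟨0, by simp, by simp⟩
    | succ n ih =>
      obtain ⟨k, hk, e⟩ := ih
      refine ⟨((n + 1 : ℕ) : K) * b ^ n + k * (b + c), v.map_le_add ?_ ?_, ?_⟩
      · rw [v.map_mul, hvbn, add_zero]; exact hnat _
      · rw [v.map_mul]
        exact add_nonneg hk (v.map_le_add hvb.ge (by rw [hv]; exact hc.le))
      · rw [pow_succ, e]; push_cast; ring
  obtain ⟨n, rfl⟩ : ∃ n, m = n + 1 := ⟨m - 1, by omega⟩
  obtain ⟨k, hk, e⟩ := key n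
  have e2 : (b + c) ^ (n + 1) - 1 = c * (((n + 1 : ℕ) : K) * b ^ n + c * k) := by
    rw [e, hb]; ring
  have hA : v (((n + 1 : ℕ) : K) * b ^ n) = 0 := by
    rw [v.map_mul, hvbn, hv, hmK, add_zero]
  have hB : 0 < v (c * k) := by
    rw [v.map_mul, hv c]; exact add_pos_of_pos_of_nonneg hc hk
  rw [e2, hmul, ← hv (_ + _), v.map_add_eq_of_lt_left (by rw [hA]; exact hB), hA, add_zero]
end

section
/- Let K be a field equipped with a valuation ω : K → ℝ ∪ {+∞} such that ω(K*) ⊇ ℤ, whose valuation ring O = {x : ω(x) ≥ 0} is Henselian. Let ℓ be a natural number, I a finite set, and (n_{j,i})_{j∈{1,…,ℓ}, i∈I} a family of integers. For t = (t₁, …, t_ℓ) ∈ (K*)^ℓ and i ∈ I, set α_i(t) = ∏_{j=1}^{ℓ} t_j^{n_{j,i}}. Then there exist a real number K₁ > 0 and a natural number L such that: for every integer n ≥ L and every t ∈ (O^×)^ℓ (i.e., ω(t_j) = 0 for all j) satisfying ω(α_i(t) − 1) ≥ n for all i ∈ I, one can write t = z·t″ (componentwise product) where z ∈ (O^×)^ℓ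 satisfies α_i(z) = 1 for all i ∈ I, and t″ ∈ (O^×)^ℓ satisfies ω(t″_j − 1) ≥ n/K₁ for all j ∈ {1, …, ℓ}. -/
open Polynomial in
theorem henselAux {R : Type*} [CommRing R] [HenselianLocalRing R] (e : ℕ) (b : R)
    (hb : b ∈ IsLocalRing.maximalIdeal R) :
    ∃ W V : R, IsUnit W ∧ IsUnit V ∧ V = W + ((e + 1 : ℕ) : R) * b ∧
      V ^ (e + 1) = W ^ (e + 1) * (1 + ((e + 1 : ℕ) : R) ^ 2 * b) := by
  have hun : ∀ c ∈ IsLocalRing.maximalIdeal R, IsUnit (1 + c) := by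
    intro c hc
    have h1 : ¬ IsUnit (-c) := by
      have : -c ∈ IsLocalRing.maximalIdeal R := neg_mem hc
      simpa using this
    rcases IsLocalRing.isUnit_or_isUnit_of_add_one (a := 1 + c) (b := -c) (by ring) with h | h
    · exact h
    · exact absurd h h1
  set g : R[X] := ∑ k ∈ Finset.range e,
    C (((e + 1).choose (k + 2) : R) * ((e + 1 : ℕ) : R) ^ k * b ^ k) * X ^ (e - 1 - k) with hg
  have hgdeg : (X ^ e + C b * g).degree ≤ (e : WithBot ℕ) := by
    refine (degree_add_le _ _).trans (max_le (degree_X_pow_le e) ?_)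
    rw [hg, Finset.mul_sum]
    refine (degree_sum_le _ _).trans (Finset.sup_le fun k _ => ?_)
    rw [← mul_assoc, ← C_mul]
    refine (degree_C_mul_X_pow_le _ _).trans ?_
    exact_mod_cast (by omega : e - 1 - k ≤ e)
  have hmon : (X ^ (e + 1) - (X ^ e + C b * g)).Monic := monic_X_pow_sub
    (lt_of_le_of_lt hgdeg (by exact_mod_cast Nat.lt_succ_self e))
  obtain ⟨W, hW, hW1⟩ := HenselianLocalRing.is_henselian _ hmon 1
    (by
      have : (X ^ (e + 1) - (X ^ e + C b * g)).eval 1 = - (b * g.eval 1) := by simp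
      rw [this]
      exact neg_mem (Ideal.mul_mem_right _ _ hb))
    (by
      have : (derivative (X ^ (e + 1) - (X ^ e + C b * g))).eval 1
          = 1 + (b * (- (derivative g).eval 1)) := by
        simp [derivative_X_pow]
        ring
      rw [this]
      exact hun _ (Ideal.mul_mem_right _ _ hb))
  have hWu : IsUnit W := by
    have := hun _ hW1
    simpa using this
  have hroot : W ^ (e + 1) = W ^ e + b * g.eval W := by
    have := hW
    simp only [IsRoot, eval_sub, eval_add, eval_pow, eval_X, eval_mul, eval_C] at this
    exact sub_eq_zero.mp this
  have hge : g.eval W = ∑ k ∈ Finset.range e,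
      (((e + 1).choose (k + 2) : R) * ((e + 1 : ℕ) : R) ^ k * b ^ k) * W ^ (e - 1 - k) := by
    rw [hg, eval_finsetSum]
    simp
  have key : (W + ((e + 1 : ℕ) : R) * b) ^ (e + 1)
      = W ^ (e + 1) * (1 + ((e + 1 : ℕ) : R) ^ 2 * b) := by
    have h1 : W ^ (e + 1) * (1 + ((e + 1 : ℕ) : R) ^ 2 * b)
      = W ^ (e + 1) + ((e + 1 : ℕ) : R) ^ 2 * b * (W ^ e + b * g.eval W) := by
      rw [← hroot]; ring
    rw [h1, hge, add_comm W, add_pow, Finset.sum_range_succ', Finset.sum_range_succ']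
    have h2 : ∑ k ∈ Finset.range e, (((e + 1 : ℕ) : R) * b) ^ (k + 1 + 1)
          * W ^ (e + 1 - (k + 1 + 1)) * ((e + 1).choose (k + 1 + 1) : R)
        = ((e + 1 : ℕ) : R) ^ 2 * b * (b * ∑ k ∈ Finset.range e,
      (((e + 1).choose (k + 2) : R) * ((e + 1 : ℕ) : R) ^ k * b ^ k) * W ^ (e - 1 - k)) := by
      rw [Finset.mul_sum, Finset.mul_sum]
      refine Finset.sum_congr rfl fun k _ => ?_
      rw [show e + 1 - (k + 1 + 1) = e - 1 - k by omega]
      ring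
    rw [h2]
    simp
    ring
  refine ⟨W, _, hWu, ?_, rfl, key⟩
  rw [← isUnit_pow_iff (n := e + 1) (by omega), key]
  exact (hWu.pow _).mul (hun _ (Ideal.mul_mem_left _ _ hb))

section
variable {K : Type*} [Field K] (ω : K → WithTop ℝ)
    (hmul : ∀ x y : K, ω (x * y) = ω x + ω y)
    (hadd : ∀ x y : K, min (ω x) (ω y) ≤ ω (x + y))
    (hzero : ∀ x : K, ω x = ⊤ ↔ x = 0)

theorem wAux_one (hmul : ∀ x y : K, ω (x * y) = ω x + ω y)
    (hzero : ∀ x : K, ω x = ⊤ ↔ x = 0) : ω 1 = 0 := by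
  have h := hmul 1 1
  have h2 : ω 1 ≠ ⊤ := by rw [Ne, hzero]; exact one_ne_zero
  lift ω 1 to ℝ using h2 with a ha
  rw [mul_one, ← ha] at h
  norm_cast at h ⊢
  linarith

theorem wAux_neg (hmul : ∀ x y : K, ω (x * y) = ω x + ω y)
    (hzero : ∀ x : K, ω x = ⊤ ↔ x = 0) (x : K) : ω (-x) = ω x := by
  have h := hmul (-1) (-1)
  have h2 : ω (-1) ≠ ⊤ := by rw [Ne, hzero]; simp
  have h3 : ω (-1) = 0 := by
    rw [neg_mul_neg, mul_one, wAux_one ω hmul hzero] at h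
    lift ω (-1) to ℝ using h2 with a ha
    norm_cast at h ⊢
    linarith
  rw [← neg_one_mul, hmul, h3, zero_add]

theorem wAux_inv (hmul : ∀ x y : K, ω (x * y) = ω x + ω y)
    (hzero : ∀ x : K, ω x = ⊤ ↔ x = 0) (x : K) (hx : ω x = 0) : ω x⁻¹ = 0 := by
  have h0 : x ≠ 0 := by
    intro h; rw [(hzero x).2 h] at hx; simp at hx
  have := hmul x x⁻¹
  rw [mul_inv_cancel₀ h0, wAux_one ω hmul hzero, hx, zero_add] at this
  exact this.symm

theorem wAux_pow (hmul : ∀ x y : K, ω (x * y) = ω x + ω y)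
    (hzero : ∀ x : K, ω x = ⊤ ↔ x = 0) (x : K) (n : ℕ) : ω (x ^ n) = n • ω x := by
  induction n with
  | zero => simp [wAux_one ω hmul hzero]
  | succ k ih => rw [pow_succ, hmul, ih, succ_nsmul]

/-- congruence subgroup -/
def congSub (hmul : ∀ x y : K, ω (x * y) = ω x + ω y)
    (hadd : ∀ x y : K, min (ω x) (ω y) ≤ ω (x + y))
    (hzero : ∀ x : K, ω x = ⊤ ↔ x = 0) (r : ℝ) : Subgroup Kˣ where
  carrier := {u | ω (u : K) = 0 ∧ (r : WithTop ℝ) ≤ ω ((u : K) - 1)}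
  one_mem' := by
    refine ⟨wAux_one ω hmul hzero, ?_⟩
    rw [Units.val_one, sub_self, (hzero 0).2 rfl]
    exact le_top
  mul_mem' := by
    rintro u v ⟨hu, hu'⟩ ⟨hv, hv'⟩
    refine ⟨by rw [Units.val_mul, hmul, hu, hv, zero_add], ?_⟩
    have : ((u * v : Kˣ) : K) - 1 = u * (v - 1) + (u - 1) := by push_cast; ring
    rw [this]
    refine le_trans (le_min ?_ hu') (hadd _ _)
    rwa [hmul, hu, zero_add]
  inv_mem' := by
    rintro u ⟨hu, hu'⟩
    have hi := wAux_inv ω hmul hzero _ hu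
    refine ⟨by rwa [Units.val_inv_eq_inv_val], ?_⟩
    have : ((u⁻¹ : Kˣ) : K) - 1 = -((u : K)⁻¹ * (u - 1)) := by
      rw [Units.val_inv_eq_inv_val]; field_simp; ring
    rw [this, wAux_neg ω hmul hzero, hmul, hi, zero_add]
    exact hu'

theorem rootAux (hmul : ∀ x y : K, ω (x * y) = ω x + ω y)
    (hadd : ∀ x y : K, min (ω x) (ω y) ≤ ω (x + y))
    (hzero : ∀ x : K, ω x = ⊤ ↔ x = 0)
    (O : Subring K) (hO : ∀ x : K, x ∈ O ↔ 0 ≤ ω x)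
    [HenselianLocalRing O] (e : ℕ) (he : ((e + 1 : ℕ) : K) ≠ 0) :
    ∃ R : ℝ, ∀ r : ℝ, R ≤ r → ∀ u : Kˣ, u ∈ congSub ω hmul hadd hzero r →
      ∃ x : Kˣ, x ∈ congSub ω hmul hadd hzero (r / 2) ∧ x ^ (e + 1) = u := by
  have hunit : ∀ V : O, IsUnit V → ω (V : K) = 0 := by
    intro V hV
    obtain ⟨V', hV'⟩ := hV.exists_right_inv
    have h1 : (V : K) * V' = 1 := by exact_mod_cast congrArg Subtype.val hV'
    have h2 := hmul V V'
    rw [h1, wAux_one ω hmul hzero] at h2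
    have h3 := (hO V).1 V.2
    have h4 := (hO V').1 V'.2
    refine le_antisymm ?_ h3
    calc ω (V : K) ≤ ω (V : K) + ω (V' : K) := le_add_of_nonneg_right h4
      _ = 0 := h2.symm
  have hw : ω ((e + 1 : ℕ) : K) ≠ ⊤ := by rw [Ne, hzero]; exact he
  obtain ⟨w, hw⟩ := WithTop.ne_top_iff_exists.1 hw
  have hw0 : 0 ≤ w := by
    have := (hO ((e + 1 : ℕ) : K)).1 (natCast_mem O (e + 1))
    rw [← hw] at this
    exact_mod_cast this
  refine ⟨2 * w + 1, fun r hr u hu => ?_⟩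
  obtain ⟨hu0, hu1⟩ := hu
  set b : K := ((u : K) - 1) / ((e + 1 : ℕ) : K) ^ 2 with hb
  have hub : (u : K) = 1 + ((e + 1 : ℕ) : K) ^ 2 * b := by rw [hb]; field_simp; ring
  have hub' : (u : K) - 1 = ((e + 1 : ℕ) : K) * (((e + 1 : ℕ) : K) * b) := by rw [hub]; ring
  rw [hub', hmul, hmul, ← hw] at hu1
  have hb1 : ((r - 2 * w : ℝ) : WithTop ℝ) ≤ ω b := by
    rcases h : ω b with _ | a
    · exact le_top
    · rw [h] at hu1
      change ((r : ℝ) : WithTop ℝ) ≤ (w : WithTop ℝ) + ((w : WithTop ℝ) + (a : WithTop ℝ)) at hu1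
      change ((r - 2 * w : ℝ) : WithTop ℝ) ≤ (a : WithTop ℝ)
      norm_cast at hu1 ⊢
      linarith
  have hb0 : 0 < ω b := lt_of_lt_of_le (by exact_mod_cast (by linarith : 0 < r - 2 * w)) hb1
  have hbm : (⟨b, (hO b).2 hb0.le⟩ : O) ∈ IsLocalRing.maximalIdeal O := by
    rw [IsLocalRing.mem_maximalIdeal]
    intro h
    have := hunit _ h
    exact hb0.ne' this
  obtain ⟨W, V, hW, hV, hVW, hp⟩ := henselAux e _ hbm
  have hW0 := hunit W hW
  have hV0 := hunit V hV
  have nz : ∀ x : K, ω x = 0 → x ≠ 0 := by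
    intro x hx h; rw [(hzero x).2 h] at hx; simp at hx
  have hWn := nz _ hW0
  have hVn := nz _ hV0
  have hVW' : (V : K) = W + ((e + 1 : ℕ) : K) * b := by
    have := congrArg Subtype.val hVW
    simpa using this
  have hp' : (V : K) ^ (e + 1) = (W : K) ^ (e + 1) * u := by
    rw [hub]
    have := congrArg Subtype.val hp
    simpa using this
  refine ⟨Units.mk0 ((V : K) / W) (div_ne_zero hVn hWn), ⟨?_, ?_⟩, ?_⟩
  · rw [Units.val_mk0, div_eq_mul_inv, hmul, hV0, wAux_inv ω hmul hzero _ hW0, zero_add]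
  · have : (V : K) / W - 1 = (W : K)⁻¹ * (((e + 1 : ℕ) : K) * b) := by
      rw [hVW']; field_simp; ring
    rw [Units.val_mk0, this, hmul, hmul, wAux_inv ω hmul hzero _ hW0, zero_add, ← hw]
    calc ((r / 2 : ℝ) : WithTop ℝ) ≤ ((w + (r - 2 * w) : ℝ) : WithTop ℝ) := by
          norm_cast; linarith
      _ = (w : WithTop ℝ) + ((r - 2 * w : ℝ) : WithTop ℝ) := by norm_cast
      _ ≤ _ := by gcongr
  · ext
    rw [Units.val_pow_eq_pow_val, Units.val_mk0, div_pow, hp']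
    field_simp

theorem natAux (hmul : ∀ x y : K, ω (x * y) = ω x + ω y)
    (hadd : ∀ x y : K, min (ω x) (ω y) ≤ ω (x + y))
    (hzero : ∀ x : K, ω x = ⊤ ↔ x = 0)
    (O : Subring K) (hO : ∀ x : K, x ∈ O ↔ 0 ≤ ω x)
    [HenselianLocalRing O] (d : ℕ) :
    ∃ c : ℝ, 0 < c ∧ ∃ R : ℝ, ∀ r : ℝ, R ≤ r → ∀ y : Kˣ, ω (y : K) = 0 →
      y ^ d ∈ congSub ω hmul hadd hzero r →
      ∃ x : Kˣ, x ∈ congSub ω hmul hadd hzero (r / c) ∧ x ^ d = y ^ d := by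
  induction d using Nat.strong_induction_on with
  | _ d ih =>
  rcases Nat.eq_zero_or_pos d with rfl | hd
  · exact ⟨1, one_pos, 0, fun r _ y _ _ => ⟨1, one_mem _, by simp⟩⟩
  by_cases hdK : (d : K) = 0
  · obtain ⟨p, hp⟩ := CharP.exists K
    have hpd : p ∣ d := (CharP.cast_eq_zero_iff K p d).1 hdK
    have hp0 : p ≠ 0 := by
      rintro rfl; rw [zero_dvd_iff] at hpd; omega
    have hpp : p.Prime := (CharP.char_is_prime_or_zero K p).resolve_right hp0
    haveI : Fact p.Prime := ⟨hpp⟩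
    obtain ⟨m, rfl⟩ := hpd
    have hm : 0 < m := Nat.pos_of_mul_pos_left hd
    obtain ⟨c, hc, R, h⟩ := ih m (by nlinarith [hpp.two_le])
    have hpr : (0 : ℝ) < p := by exact_mod_cast hpp.pos
    refine ⟨p * c, by positivity, p * R, fun r hr y hy hyd => ?_⟩
    obtain ⟨x, hx, hxy⟩ := h (r / p) (by rw [le_div_iff₀ hpr]; linarith) y hy (by
      refine ⟨by rw [Units.val_pow_eq_pow_val, wAux_pow ω hmul hzero, hy, smul_zero], ?_⟩
      have h1 := hyd.2
      have h2 : ((y ^ (p * m) : Kˣ) : K) - 1 = ((y ^ m : Kˣ) - 1 : K) ^ p := by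
        rw [sub_pow_char, one_pow]; push_cast; rw [← pow_mul, mul_comm]
      rw [h2, wAux_pow ω hmul hzero] at h1
      rcases h3 : ω (((y ^ m : Kˣ) : K) - 1) with _ | a
      · exact le_top
      · rw [h3] at h1
        change (r : WithTop ℝ) ≤ p • (a : WithTop ℝ) at h1
        change ((r / p : ℝ) : WithTop ℝ) ≤ (a : WithTop ℝ)
        norm_cast at h1 ⊢
        rw [div_le_iff₀ hpr]
        rw [nsmul_eq_mul] at h1
        linarith)
    refine ⟨x, by rwa [← div_div], ?_⟩
    rw [mul_comm p m, pow_mul, hxy, pow_mul]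
  · obtain ⟨e, rfl⟩ : ∃ e, d = e + 1 := ⟨d - 1, by omega⟩
    obtain ⟨R, h⟩ := rootAux ω hmul hadd hzero O hO e hdK
    exact ⟨2, two_pos, R, fun r hr y _ hyd => h r hr _ hyd⟩

theorem intAux (hmul : ∀ x y : K, ω (x * y) = ω x + ω y)
    (hadd : ∀ x y : K, min (ω x) (ω y) ≤ ω (x + y))
    (hzero : ∀ x : K, ω x = ⊤ ↔ x = 0)
    (O : Subring K) (hO : ∀ x : K, x ∈ O ↔ 0 ≤ ω x)
    [HenselianLocalRing O] (d : ℤ) :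
    ∃ c : ℝ, 0 < c ∧ ∃ R : ℝ, ∀ r : ℝ, R ≤ r → ∀ y : Kˣ, ω (y : K) = 0 →
      y ^ d ∈ congSub ω hmul hadd hzero r →
      ∃ x : Kˣ, x ∈ congSub ω hmul hadd hzero (r / c) ∧ x ^ d = y ^ d := by
  obtain ⟨c, hc, R, h⟩ := natAux ω hmul hadd hzero O hO d.natAbs
  refine ⟨c, hc, R, fun r hr y hy hyd => ?_⟩
  rcases Int.natAbs_eq d with hd | hd
  · rw [hd, zpow_natCast] at hyd ⊢
    simp only [zpow_natCast]
    exact h r hr y hy hyd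
  · rw [hd, zpow_neg, zpow_natCast, inv_mem_iff] at hyd
    obtain ⟨x, hx, hxy⟩ := h r hr y hy hyd
    refine ⟨x, hx, ?_⟩
    rw [hd, zpow_neg, zpow_neg, zpow_natCast, zpow_natCast, hxy]

theorem congSub_mono (hmul : ∀ x y : K, ω (x * y) = ω x + ω y)
    (hadd : ∀ x y : K, min (ω x) (ω y) ≤ ω (x + y))
    (hzero : ∀ x : K, ω x = ⊤ ↔ x = 0) {r s : ℝ} (h : r ≤ s) :
    congSub ω hmul hadd hzero s ≤ congSub ω hmul hadd hzero r := fun _ hu =>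
  ⟨hu.1, le_trans (by exact_mod_cast h) hu.2⟩

end


/-- Lemma 4.15: over a Henselian valued field with `ω (K*) ⊇ ℤ`, elements `t` of the torus
`(O^×)^ℓ` on which the characters `α_i (t) = ∏ⱼ t_j ^ (n_{j,i})` are close to `1`
(valuation at least `n ≥ L`) factor as `t = z * t''` with `α_i (z) = 1` for all `i`
and `ω (t''_j - 1) ≥ n / K₁` for all `j`. -/
theorem stmt_4 {K : Type*} [Field K] (ω : K → WithTop ℝ)
    (hmul : ∀ x y : K, ω (x * y) = ω x + ω y)
    (hadd : ∀ x y : K, min (ω x) (ω y) ≤ ω (x + y))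
    (hzero : ∀ x : K, ω x = ⊤ ↔ x = 0)
    (hZ : ∀ k : ℤ, ∃ x : K, x ≠ 0 ∧ ω x = ((k : ℝ) : WithTop ℝ))
    (O : Subring K) (hO : ∀ x : K, x ∈ O ↔ 0 ≤ ω x)
    [HenselianLocalRing O]
    (ℓ : ℕ) {I : Type*} [Fintype I] (N : Fin ℓ → I → ℤ) :
    ∃ K₁ : ℝ, 0 < K₁ ∧ ∃ L : ℕ,
      ∀ n : ℕ, L ≤ n → ∀ t : Fin ℓ → K, (∀ j, ω (t j) = 0) →
        (∀ i : I, ((n : ℝ) : WithTop ℝ) ≤ ω ((∏ j, t j ^ (N j i)) - 1)) →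
        ∃ z t'' : Fin ℓ → K,
          (∀ j, ω (z j) = 0) ∧ (∀ j, ω (t'' j) = 0) ∧
          (∀ j, t j = z j * t'' j) ∧
          (∀ i : I, (∏ j, z j ^ (N j i)) = 1) ∧
          (∀ j, (((n : ℝ) / K₁ : ℝ) : WithTop ℝ) ≤ ω (t'' j - 1)) := by
  classical
  obtain ⟨m, snf⟩ := Submodule.smithNormalForm (Pi.basisFun ℤ (Fin ℓ))
    (Submodule.span ℤ (Set.range fun i j => N j i))
  obtain ⟨bM, bN, f, a, hsnf⟩ := snf
  choose c hc R hR using fun k => intAux ω hmul hadd hzero O hO (a k)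
  obtain ⟨C, hC⟩ := Finite.exists_le c
  obtain ⟨R', hR'⟩ := Finite.exists_le R
  have hC1 : 0 < max C 1 := lt_max_of_lt_right one_pos
  refine ⟨max C 1, hC1, ⌈R'⌉₊, fun n hn t ht hα => ?_⟩
  have hn' : R' ≤ n := (Nat.le_ceil _).trans (by exact_mod_cast hn)
  have nz : ∀ x : K, ω x = 0 → x ≠ 0 := by
    intro x hx h; rw [(hzero x).2 h] at hx; simp at hx
  let τ : Fin ℓ → Kˣ := fun j => Units.mk0 (t j) (nz _ (ht j))
  let G := congSub ω hmul hadd hzero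
  let φ : (Fin ℓ → ℤ) →ₗ[ℤ] Additive Kˣ :=
    (Pi.basisFun ℤ (Fin ℓ)).constr ℤ (fun j => Additive.ofMul (τ j))
  have hev : ∀ (σ : Fin ℓ → Kˣ) (ρ : (Fin ℓ → ℤ) →ₗ[ℤ] Additive Kˣ),
      (∀ j, ρ (Pi.basisFun ℤ (Fin ℓ) j) = Additive.ofMul (σ j)) → ∀ v : Fin ℓ → ℤ,
      (ρ v).toMul = ∏ j, σ j ^ v j := by
    intro σ ρ hρ v
    conv_lhs => rw [← (Pi.basisFun ℤ (Fin ℓ)).sum_repr v]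
    rw [map_sum, toMul_sum]
    refine Finset.prod_congr rfl fun j _ => ?_
    rw [map_smul, hρ]
    simp
  have hφ := hev τ φ (fun j => by simp only [φ, Module.Basis.constr_basis])
  have hφ0 : ∀ v, ω ((φ v).toMul : K) = 0 := by
    obtain ⟨r, hr⟩ : ∃ r : ℝ, ∀ j, τ j ∈ G r := by
      have : ∀ j, ∃ r : ℝ, (-r : ℝ) ≤ ω (t j - 1) := by
        intro j
        rcases h : ω (t j - 1) with _ | s
        · exact ⟨0, le_top⟩
        · exact ⟨-s, by simp; rfl⟩
      choose r hr using this
      obtain ⟨s, hs⟩ := Finite.exists_le r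
      refine ⟨-s, fun j => ⟨ht j, le_trans ?_ (hr j)⟩⟩
      exact_mod_cast neg_le_neg (hs j)
    intro v
    have : (φ v).toMul ∈ G r := by
      rw [hφ]
      exact Subgroup.prod_mem _ fun j _ => Subgroup.zpow_mem _ (hr j) _
    exact this.1
  have hspan : ∀ v ∈ Submodule.span ℤ (Set.range fun i j => N j i), (φ v).toMul ∈ G n := by
    intro v hv
    induction hv using Submodule.span_induction with
    | mem x hx =>
      obtain ⟨i, rfl⟩ := hx
      refine ⟨hφ0 _, ?_⟩
      rw [hφ]
      simpa [τ] using hα i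
    | zero => simpa using one_mem (G n)
    | add x y _ _ hx hy => simpa using mul_mem hx hy
    | smul k x _ hx => rw [map_smul, toMul_zsmul]; exact Subgroup.zpow_mem _ hx k
  have hx : ∀ k, ∃ x : Kˣ, x ∈ G (n / c k) ∧ x ^ a k = (φ (bM (f k))).toMul ^ a k := by
    intro k
    refine hR k n ((hR' k).trans hn') _ (hφ0 _) ?_
    have := hspan (bN k) (bN k).2
    rw [hsnf, map_smul, toMul_zsmul] at this
    exact this
  choose x hxG hxe using hx
  let ψ : (Fin ℓ → ℤ) →ₗ[ℤ] Additive Kˣ :=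
    bM.constr ℤ (fun j => if h : ∃ k, f k = j then Additive.ofMul (x h.choose) else 0)
  have hψf : ∀ k, ψ (bM (f k)) = Additive.ofMul (x k) := by
    intro k
    have h : ∃ k', f k' = f k := ⟨k, rfl⟩
    have h2 : h.choose = k := f.injective h.choose_spec
    simp only [ψ, Module.Basis.constr_basis]
    rw [dif_pos h, h2]
  have hψG : ∀ v, (ψ v).toMul ∈ G (n / max C 1) := by
    intro v
    rw [← bM.sum_repr v, map_sum, toMul_sum]
    refine Subgroup.prod_mem _ fun j _ => ?_
    rw [map_smul, toMul_zsmul]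
    refine Subgroup.zpow_mem _ ?_ _
    by_cases h : ∃ k, f k = j
    · obtain ⟨k, rfl⟩ := h
      rw [hψf]
      refine congSub_mono ω hmul hadd hzero ?_ (hxG k)
      exact div_le_div_of_nonneg_left (Nat.cast_nonneg n) (hc k) ((hC k).trans (le_max_left _ _))
    · simp only [ψ, Module.Basis.constr_basis]
      rw [dif_neg h]
      exact one_mem _
  have hEq : ∀ v ∈ Submodule.span ℤ (Set.range fun i j => N j i), φ v = ψ v := by
    intro v hv
    have :
        φ.comp (Submodule.subtype (Submodule.span ℤ (Set.range fun i j => N j i)))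
        = ψ.comp (Submodule.subtype (Submodule.span ℤ (Set.range fun i j => N j i))) := by
      refine bN.ext fun k => ?_
      simp only [LinearMap.comp_apply, Submodule.subtype_apply]
      rw [hsnf, map_smul, map_smul, hψf]
      apply Additive.toMul.injective
      rw [toMul_zsmul, toMul_zsmul, ← hxe]
      rfl
    exact LinearMap.congr_fun this ⟨v, hv⟩
  let s : Fin ℓ → Kˣ := fun j => (ψ (Pi.basisFun ℤ (Fin ℓ) j)).toMul
  have hψ := hev s ψ (fun j => rfl)
  have hs : ∀ j, s j ∈ G (n / max C 1) := fun j => hψG _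
  refine ⟨fun j => t j * (s j : K)⁻¹, fun j => s j, fun j => ?_, fun j => (hs j).1, fun j => ?_,
    fun i => ?_, fun j => (hs j).2⟩
  · rw [hmul, ht, wAux_inv ω hmul hzero _ (hs j).1, zero_add]
  · simp
  · have h1 := hEq _ (Submodule.subset_span ⟨i, rfl⟩)
    have h2 := congrArg Additive.toMul h1
    rw [hφ, hψ] at h2
    have h3 : ∏ j, (τ j * (s j)⁻¹) ^ N j i = 1 := by
      simp_rw [mul_zpow, Finset.prod_mul_distrib, inv_zpow, Finset.prod_inv_distrib]
      rw [h2, mul_inv_cancel]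
    have h4 := congrArg (Units.val) h3
    simpa [τ] using h4
end

section
/- Let K be a field equipped with a valuation ω : K → ℝ ∪ {+∞}, with valuation ring O = {x : ω(x) ≥ 0}. Let n be a positive real number and let M ∈ SL₂(O) be a matrix all of whose entries are congruent to those of the identity matrix up to valuation at least n, i.e., ω(M₁₁ − 1) ≥ n, ω(M₁₂) ≥ n, ω(M₂₁) ≥ n, ω(M₂₂ − 1) ≥ n. Then there exist a, b ∈ K with ω(a) ≥ n and ω(b) ≥ n, and t ∈ K* with ω(t − 1) ≥ n, such that M = x₊(a) · x₋(b) · h(t). -/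
/-- Decomposition of the `n`-th congruence subgroup of `SL₂ (O)`:
a matrix `M ∈ SL₂ (O)` congruent to the identity up to valuation `n > 0` decomposes as
`M = x₊(a) · x₋(b) · h(t)` with `ω a ≥ n`, `ω b ≥ n` and `ω (t - 1) ≥ n`. -/
theorem stmt_6 {K : Type*} [Field K] (ω : K → WithTop ℝ)
    (hmul : ∀ x y : K, ω (x * y) = ω x + ω y)
    (hadd : ∀ x y : K, min (ω x) (ω y) ≤ ω (x + y))
    (hzero : ∀ x : K, ω x = ⊤ ↔ x = 0)
    (n : ℝ) (hn : 0 < n)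
    (M : Matrix.SpecialLinearGroup (Fin 2) K)
    (h11 : ((n : ℝ) : WithTop ℝ) ≤ ω ((M : Matrix (Fin 2) (Fin 2) K) 0 0 - 1))
    (h12 : ((n : ℝ) : WithTop ℝ) ≤ ω ((M : Matrix (Fin 2) (Fin 2) K) 0 1))
    (h21 : ((n : ℝ) : WithTop ℝ) ≤ ω ((M : Matrix (Fin 2) (Fin 2) K) 1 0))
    (h22 : ((n : ℝ) : WithTop ℝ) ≤ ω ((M : Matrix (Fin 2) (Fin 2) K) 1 1 - 1)) :
    ∃ a b t : K, t ≠ 0 ∧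
      ((n : ℝ) : WithTop ℝ) ≤ ω a ∧
      ((n : ℝ) : WithTop ℝ) ≤ ω b ∧
      ((n : ℝ) : WithTop ℝ) ≤ ω (t - 1) ∧
      (M : Matrix (Fin 2) (Fin 2) K) =
        !![1, a; 0, 1] * !![1, 0; b, 1] * !![t, 0; 0, t⁻¹] := by
  have z0 : ∀ w : WithTop ℝ, w ≠ ⊤ → w = w + w → w = 0 := by
    intro w hw h
    lift w to ℝ using hw
    have h' : w = w + w := by exact_mod_cast h
    have : w = 0 := by linarith
    exact_mod_cast this
  have w1 : ω 1 = 0 := z0 _ (by simp [hzero]) (by rw [← hmul, one_mul])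
  have wm : ω (-1) = 0 := by
    have h := hmul (-1) (-1)
    rw [neg_one_mul, neg_neg, w1] at h
    have hT : ω (-1) ≠ ⊤ := by simp [hzero]
    generalize ω (-1) = w at h hT
    lift w to ℝ using hT
    have h' : 0 = w + w := by exact_mod_cast h
    have : w = 0 := by linarith
    exact_mod_cast this
  have hdet := M.det_coe
  rw [Matrix.det_fin_two] at hdet
  generalize hA : (M : Matrix (Fin 2) (Fin 2) K) = A at *
  have hn' : (0 : WithTop ℝ) < ((n : ℝ) : WithTop ℝ) := by exact_mod_cast hn
  have hd1 : 0 < ω (A 1 1 - 1) := lt_of_lt_of_le hn' h22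
  have hge : 0 ≤ ω (A 1 1) := by
    have h := hadd (A 1 1 - 1) 1
    rw [sub_add_cancel, w1, min_eq_right hd1.le] at h
    exact h
  have hle : ω (A 1 1) ≤ 0 := by
    have h := hadd (A 1 1) (-1 * (A 1 1 - 1))
    rw [hmul (-1), wm, zero_add, show A 1 1 + -1 * (A 1 1 - 1) = 1 by ring, w1] at h
    rcases min_le_iff.1 h with h | h
    · exact h
    · exact absurd h (not_le.2 hd1)
  have hd : ω (A 1 1) = 0 := le_antisymm hle hge
  have hne : A 1 1 ≠ 0 := by
    intro h
    rw [(hzero _).2 h] at hd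
    exact absurd hd (by simp)
  have hi : ω (A 1 1)⁻¹ = 0 := by
    have h := hmul (A 1 1) (A 1 1)⁻¹
    rw [mul_inv_cancel₀ hne, w1, hd, zero_add] at h
    exact h.symm
  refine ⟨A 0 1 * (A 1 1)⁻¹, A 1 0 * A 1 1, (A 1 1)⁻¹, inv_ne_zero hne, ?_, ?_, ?_, ?_⟩
  · rw [hmul, hi, add_zero]; exact h12
  · rw [hmul, hd, add_zero]; exact h21
  · rw [show (A 1 1)⁻¹ - 1 = -1 * (A 1 1 - 1) * (A 1 1)⁻¹ by field_simp; ring,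
      hmul, hmul, wm, hi, add_zero, zero_add]
    exact h22
  · ext i j
    fin_cases i <;> fin_cases j <;> simp [Matrix.mul_apply, Fin.sum_univ_two] <;> field_simp
    linear_combination hdet
end

section
/- Let K be a field equipped with a valuation ω : K → ℝ ∪ {+∞}, and let r, N be real numbers with r ≥ N > 0. Then the subset of SL₂(K) consisting of all products x₊(a) · x₋(b) · h(t), where a, b ∈ K satisfy ω(a) ≥ r and ω(b) ≥ r, and t ∈ K* satisfies ω(t − 1) ≥ 2N, is a subgroup of SL₂(K). -/
/-- Rank-one form of Lemma 4.2: for `r ≥ N > 0`, the set of products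
`x₊(a) · x₋(b) · h(t)` in `SL₂ (K)` with `ω a ≥ r`, `ω b ≥ r` and `ω (t - 1) ≥ 2N`
is a subgroup of `SL₂ (K)`. -/
theorem stmt_7 {K : Type*} [Field K] (ω : K → WithTop ℝ)
    (hmul : ∀ x y : K, ω (x * y) = ω x + ω y)
    (hadd : ∀ x y : K, min (ω x) (ω y) ≤ ω (x + y))
    (hzero : ∀ x : K, ω x = ⊤ ↔ x = 0)
    (r N : ℝ) (hrN : N ≤ r) (hN : 0 < N) :
    ∃ H : Subgroup (Matrix.SpecialLinearGroup (Fin 2) K),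
      (H : Set (Matrix.SpecialLinearGroup (Fin 2) K)) =
        {g : Matrix.SpecialLinearGroup (Fin 2) K | ∃ a b t : K, t ≠ 0 ∧
          ((r : ℝ) : WithTop ℝ) ≤ ω a ∧
          ((r : ℝ) : WithTop ℝ) ≤ ω b ∧
          ((2 * N : ℝ) : WithTop ℝ) ≤ ω (t - 1) ∧
          (g : Matrix (Fin 2) (Fin 2) K) =
            !![1, a; 0, 1] * !![1, 0; b, 1] * !![t, 0; 0, t⁻¹]} := by
  have A : ∀ (c : WithTop ℝ) (x y : K), c ≤ ω x → c ≤ ω y → c ≤ ω (x + y) :=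
    fun c x y hx hy => (le_min hx hy).trans (hadd x y)
  have M : ∀ (c : WithTop ℝ) (x y : K), c ≤ ω x → 0 ≤ ω y → c ≤ ω (x * y) := by
    intro c x y hx hy
    rw [hmul]
    exact le_add_of_le_of_nonneg hx hy
  have dbl : ∀ z : WithTop ℝ, z ≠ ⊤ → z + z = z → z = 0 := by
    intro z hz h
    lift z to ℝ using hz
    norm_cast at h ⊢
    linarith
  have dbl0 : ∀ z : WithTop ℝ, z ≠ ⊤ → z + z = 0 → z = 0 := by
    intro z hz h
    lift z to ℝ using hz
    norm_cast at h ⊢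
    linarith
  have w1 : ω 1 = 0 := by
    apply dbl
    · intro h
      exact one_ne_zero ((hzero 1).1 h)
    · rw [← hmul, one_mul]
  have wm1 : ω (-1) = 0 := by
    apply dbl0
    · intro h
      exact (neg_ne_zero.2 one_ne_zero) ((hzero (-1)).1 h)
    · rw [← hmul]
      simp [w1]
  have wneg : ∀ x, ω (-x) = ω x := by
    intro x
    rw [← neg_one_mul, hmul, wm1, zero_add]
  have c0 : (0 : WithTop ℝ) < ((2 * N : ℝ) : WithTop ℝ) := by
    have : (0 : ℝ) < 2 * N := by linarith
    exact_mod_cast this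
  have r0 : (0 : WithTop ℝ) ≤ ((r : ℝ) : WithTop ℝ) := by
    have : (0 : ℝ) ≤ r := by linarith
    exact_mod_cast this
  have U : ∀ t : K, ((2 * N : ℝ) : WithTop ℝ) ≤ ω (t - 1) → ω t = 0 := by
    intro t ht
    apply le_antisymm
    · have h := hadd t (-(t - 1))
      rw [wneg, show t + -(t - 1) = 1 by ring, w1] at h
      rcases min_le_iff.1 h with h | h
      · exact h
      · exact absurd (c0.trans_le ht) (not_lt.2 h)
    · have h := A 0 (t - 1) 1 (c0.le.trans ht) w1.ge
      simpa using h
  have I : ∀ t : K, ((2 * N : ℝ) : WithTop ℝ) ≤ ω (t - 1) →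
      t ≠ 0 ∧ ω t⁻¹ = 0 ∧ ((2 * N : ℝ) : WithTop ℝ) ≤ ω (t⁻¹ - 1) := by
    intro t ht
    have h0 : t ≠ 0 := by
      intro h
      have := U t ht
      rw [(hzero t).2 h] at this
      exact absurd this (by simp)
    have h1 : ω t⁻¹ = 0 := by
      have := hmul t t⁻¹
      rw [mul_inv_cancel₀ h0, w1, U t ht, zero_add] at this
      exact this.symm
    refine ⟨h0, h1, ?_⟩
    rw [show t⁻¹ - 1 = (-(t - 1)) * t⁻¹ by field_simp; ring]
    exact M _ _ _ (by rwa [wneg]) h1.ge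
  have R : ∀ x y : K, ((r : ℝ) : WithTop ℝ) ≤ ω x → ((r : ℝ) : WithTop ℝ) ≤ ω y →
      ((2 * N : ℝ) : WithTop ℝ) ≤ ω (x * y) := by
    intro x y hx hy
    rw [hmul]
    refine le_trans ?_ (add_le_add hx hy)
    have : 2 * N ≤ r + r := by linarith
    exact_mod_cast this
  have key : ∀ g : Matrix.SpecialLinearGroup (Fin 2) K, (∃ a b t : K, t ≠ 0 ∧
          ((r : ℝ) : WithTop ℝ) ≤ ω a ∧
          ((r : ℝ) : WithTop ℝ) ≤ ω b ∧
          ((2 * N : ℝ) : WithTop ℝ) ≤ ω (t - 1) ∧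
          (g : Matrix (Fin 2) (Fin 2) K) =
            !![1, a; 0, 1] * !![1, 0; b, 1] * !![t, 0; 0, t⁻¹]) ↔
      (((r : ℝ) : WithTop ℝ) ≤ ω (g.1 0 1) ∧ ((r : ℝ) : WithTop ℝ) ≤ ω (g.1 1 0) ∧
        ((2 * N : ℝ) : WithTop ℝ) ≤ ω (g.1 0 0 - 1) ∧
        ((2 * N : ℝ) : WithTop ℝ) ≤ ω (g.1 1 1 - 1)) := by
    intro g
    constructor
    · rintro ⟨a, b, t, -, ha, hb, ht, hg⟩
      obtain ⟨h0, h1, h2⟩ := I t ht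
      have e00 : g.1 0 0 = (1 + a * b) * t := by rw [hg]; simp
      have e01 : g.1 0 1 = a * t⁻¹ := by rw [hg]; simp
      have e10 : g.1 1 0 = b * t := by rw [hg]; simp
      have e11 : g.1 1 1 = t⁻¹ := by rw [hg]; simp
      rw [e00, e01, e10, e11]
      refine ⟨M _ _ _ ha h1.ge, M _ _ _ hb (U t ht).ge, ?_, h2⟩
      rw [show (1 + a * b) * t - 1 = (t - 1) + a * b * t by ring]
      exact A _ _ _ ht (M _ _ _ (R _ _ ha hb) (U t ht).ge)
    · rintro ⟨h01, h10, h00, h11⟩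
      obtain ⟨h0, h1, h2⟩ := I _ h11
      have hd : g.1 0 0 * g.1 1 1 - g.1 0 1 * g.1 1 0 = 1 := by
        rw [← Matrix.det_fin_two]; exact g.2
      refine ⟨g.1 0 1 * (g.1 1 1)⁻¹, g.1 1 0 * g.1 1 1, (g.1 1 1)⁻¹, inv_ne_zero h0,
        M _ _ _ h01 h1.ge, M _ _ _ h10 (U _ h11).ge, h2, ?_⟩
      ext i j
      fin_cases i <;> fin_cases j <;> simp
      · field_simp
        linear_combination hd
      · field_simp
      · field_simp
  simp only [key]
  refine ⟨{ carrier := {g | _}, mul_mem' := ?_, one_mem' := ?_, inv_mem' := ?_ }, rfl⟩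
  · rintro g h ⟨g01, g10, g00, g11⟩ ⟨h01, h10, h00, h11⟩
    have E : ∀ i j, (g * h).1 i j = g.1 i 0 * h.1 0 j + g.1 i 1 * h.1 1 j := by
      intro i j
      change (g.1 * h.1) i j = _
      rw [Matrix.mul_apply, Fin.sum_univ_two]
    simp only [Set.mem_setOf_eq, E]
    refine ⟨?_, ?_, ?_, ?_⟩
    · refine A _ _ _ ?_ (M _ _ _ g01 (U _ h11).ge)
      rw [mul_comm]
      exact M _ _ _ h01 (U _ g00).ge
    · refine A _ _ _ (M _ _ _ g10 (U _ h00).ge) ?_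
      rw [mul_comm]
      exact M _ _ _ h10 (U _ g11).ge
    · rw [show g.1 0 0 * h.1 0 0 + g.1 0 1 * h.1 1 0 - 1 =
        ((g.1 0 0 - 1) * h.1 0 0 + (h.1 0 0 - 1)) + g.1 0 1 * h.1 1 0 by ring]
      exact A _ _ _ (A _ _ _ (M _ _ _ g00 (U _ h00).ge) h00) (R _ _ g01 h10)
    · rw [show g.1 1 0 * h.1 0 1 + g.1 1 1 * h.1 1 1 - 1 =
        ((g.1 1 1 - 1) * h.1 1 1 + (h.1 1 1 - 1)) + g.1 1 0 * h.1 0 1 by ring]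
      exact A _ _ _ (A _ _ _ (M _ _ _ g11 (U _ h11).ge) h11) (R _ _ g10 h01)
  · have z : ω 0 = ⊤ := (hzero 0).2 rfl
    simp [z]
  · rintro g ⟨g01, g10, g00, g11⟩
    have E : (g⁻¹).1 = !![g.1 1 1, -g.1 0 1; -g.1 1 0, g.1 0 0] :=
      Matrix.adjugate_fin_two g.1
    simp only [Set.mem_setOf_eq, E]
    simp [wneg]
    exact ⟨g01, g10, by simpa using g11, by simpa using g00⟩
end
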